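/- Let f be a real polynomial in two variables of degree d >= 1 whose real zero set Z(f) = {(x,y) : f(x,y) = 0} is finite. Then Z(f) contains at most d(d-1) points. -/

import Mathlib

namespace MvPolynomial

open Module

section Bezout

variable {K : Type*} [Field K]

theorem two_mul_finrank_restrictTotalDegree_fin_two (n : ℕ) :
    2 * finrank K (restrictTotalDegree (Fin 2) K n) = (n + 1) * (n + 2) := by
  have hcard : finrank K (restrictTotalDegree (Fin 2) K n) =
      ((Finset.range (n + 1)).sigma fun k => Finset.HasAntidiagonal.antidiagonal k).card := by
    rw [restrictTotalDegree, finrank_eq_nat_card_basis (basisRestrictSupport K _),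
      ← Nat.card_eq_finsetCard]
    refine Nat.card_congr
      { toFun := fun v => ⟨⟨v.1 0 + v.1 1, (v.1 0, v.1 1)⟩, ?_⟩
        invFun := fun q =>
          ⟨Finsupp.equivFunOnFinite.symm ![q.1.2.1, q.1.2.2], ?_⟩
        left_inv := ?_
        right_inv := ?_ }
    · have hv : (v.1.sum fun _ e => e) ≤ n := v.2
      rw [Finsupp.sum_fintype _ _ fun _ => rfl, Fin.sum_univ_two] at hv
      simpa using hv
    · have := q.2
      simp only [Finset.mem_sigma, Finset.mem_range, Finset.HasAntidiagonal.mem_antidiagonal] at this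
      rw [Set.mem_ofPred_eq, Finsupp.sum_fintype _ _ fun _ => rfl, Fin.sum_univ_two]
      simp only [Finsupp.equivFunOnFinite_symm_apply_apply, Matrix.cons_val_zero,
        Matrix.cons_val_one]
      omega
    · rintro ⟨v, hv⟩
      ext i
      fin_cases i <;> simp
    · rintro ⟨⟨k, a, b⟩, hq⟩
      simp only [Finset.mem_sigma, Finset.mem_range, Finset.HasAntidiagonal.mem_antidiagonal] at hq
      obtain ⟨-, rfl⟩ := hq
      simp
  rw [hcard, Finset.card_sigma]
  simp only [Finset.Nat.card_antidiagonal]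
  clear hcard
  induction n with
  | zero => simp
  | succ n ih =>
    rw [Finset.sum_range_succ, mul_add, ih]
    ring

theorem exists_eval_eq_one_and_eval_eq_zero {σ : Type*} (s : Finset (σ → K)) (p : σ → K) :
    ∃ L : MvPolynomial σ K, eval p L = 1 ∧ ∀ q ∈ s, q ≠ p → eval q L = 0 := by
  classical
  induction s using Finset.induction_on with
  | empty => exact ⟨1, by simp⟩
  | insert a s ha ih =>
    obtain ⟨L, hLp, hL⟩ := ih
    by_cases hap : a = p
    · refine ⟨L, hLp, fun q hq hqp => hL q ?_ hqp⟩
      exact Finset.mem_of_mem_insert_of_ne hq (hap ▸ hqp)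
    · obtain ⟨i, hi⟩ := Function.ne_iff.mp hap
      have hi' : p i - a i ≠ 0 := sub_ne_zero.mpr (Ne.symm hi)
      refine ⟨L * (X i - C (a i)) * C (p i - a i)⁻¹, by simp [hLp, hi'], fun q hq hqp => ?_⟩
      rcases Finset.mem_insert.mp hq with rfl | hq
      · simp
      · simp [hL q hq hqp]

/-- Polynomials of large enough degree interpolate arbitrary values on a finite set. -/
theorem exists_forall_le_finrank_inf_ker_evals {σ : Type*} [Finite σ] (s : Finset (σ → K)) :
    ∃ D : ℕ, ∀ k, D ≤ k →
      s.card + finrank K ↥(restrictTotalDegree σ K k ⊓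
        LinearMap.ker (LinearMap.pi fun p : s => (aeval (R := K) p.1).toLinearMap)) =
      finrank K (restrictTotalDegree σ K k) := by
  classical
  choose L hL₁ hL₀ using exists_eval_eq_one_and_eval_eq_zero (K := K) s
  refine ⟨s.sup fun p => (L p).totalDegree, fun k hk => ?_⟩
  set ev : MvPolynomial σ K →ₗ[K] (s → K) :=
    LinearMap.pi fun p : s => (aeval (R := K) p.1).toLinearMap with hev
  have hsurj : LinearMap.range (ev.domRestrict (restrictTotalDegree σ K k)) = ⊤ := by
    rw [eq_top_iff, ← (Pi.basisFun K s).span_eq, Submodule.span_le]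
    rintro _ ⟨p, rfl⟩
    refine ⟨⟨L p, (mem_restrictTotalDegree _ _ _).2
      ((Finset.le_sup (f := fun p => (L p).totalDegree) p.2).trans hk)⟩, ?_⟩
    ext q
    by_cases hqp : q = p
    · subst hqp
      simpa [hev, aeval_eq_eval] using hL₁ q
    · simpa [hev, aeval_eq_eval, hqp, Pi.single_apply] using
        hL₀ p q q.2 (fun h => hqp (Subtype.ext h))
  have h := (ev.domRestrict (restrictTotalDegree σ K k)).finrank_range_add_finrank_ker
  rw [hsurj, finrank_top, finrank_fintype_fun_eq_card, Fintype.card_coe,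
    LinearMap.ker_domRestrict] at h
  rw [← h, ← Submodule.map_comap_subtype, Submodule.finrank_map_subtype_eq]

theorem finrank_map_mulLeft {σ : Type*} {f : MvPolynomial σ K} (hf : f ≠ 0)
    (V : Submodule K (MvPolynomial σ K)) :
    finrank K (V.map (LinearMap.mulLeft K f)) = finrank K V :=
  (Submodule.equivMapOfInjective _ (mul_right_injective₀ hf) V).finrank_eq.symm

/-- The bound in Bézout's theorem for plane curves without a common component. -/
theorem card_le_totalDegree_mul_totalDegree {f g : MvPolynomial (Fin 2) K} (hf : f ≠ 0)
    (hg : g ≠ 0) (hfg : IsRelPrime f g) (s : Finset (Fin 2 → K))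
    (hs : ∀ p ∈ s, eval p f = 0 ∧ eval p g = 0) :
    s.card ≤ f.totalDegree * g.totalDegree := by
  obtain ⟨D, hD⟩ := exists_forall_le_finrank_inf_ker_evals s
  set m := f.totalDegree
  set n := g.totalDegree
  have key := hD (m + n + D) (by omega)
  set V := restrictTotalDegree (Fin 2) K with hV
  set N := LinearMap.ker (LinearMap.pi fun p : s => (aeval (R := K) p.1).toLinearMap)
  set A := (V (n + D)).map (LinearMap.mulLeft K f)
  set B := (V (m + D)).map (LinearMap.mulLeft K g)
  have hsup : A ⊔ B ≤ V (m + n + D) ⊓ N := by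
    refine sup_le ?_ ?_ <;> rintro _ ⟨q, hq, rfl⟩ <;>
      refine ⟨(mem_restrictTotalDegree _ _ _).2 ?_, ?_⟩
    · have := (mem_restrictTotalDegree _ _ _).1 hq
      have := totalDegree_mul f q
      simp only [LinearMap.mulLeft_apply]
      omega
    · ext p
      simp [aeval_eq_eval, (hs p p.2).1]
    · have := (mem_restrictTotalDegree _ _ _).1 hq
      have := totalDegree_mul g q
      simp only [LinearMap.mulLeft_apply]
      omega
    · ext p
      simp [aeval_eq_eval, (hs p p.2).2]
  have hinf : A ⊓ B ≤ (V D).map (LinearMap.mulLeft K (f * g)) := by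
    rintro _ ⟨⟨a, ha, rfl⟩, ⟨b, hb, hab⟩⟩
    simp only [LinearMap.mulLeft_apply] at hab ⊢
    obtain ⟨c, rfl⟩ : g ∣ a := hfg.symm.dvd_of_dvd_mul_left ⟨b, hab.symm⟩
    refine ⟨c, (mem_restrictTotalDegree _ _ _).2 ?_, by simp⟩
    rcases eq_or_ne c 0 with rfl | hc
    · simp
    have := (mem_restrictTotalDegree _ _ _).1 ha
    rw [totalDegree_mul_of_isDomain hg hc] at this
    omega
  have h₁ := Submodule.finrank_mono hsup
  have h₂ := Submodule.finrank_mono hinf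
  have h₃ := Submodule.finrank_sup_add_finrank_inf_eq A B
  rw [finrank_map_mulLeft (mul_ne_zero hf hg)] at h₂
  rw [finrank_map_mulLeft hf, finrank_map_mulLeft hg] at h₃
  have d₁ := two_mul_finrank_restrictTotalDegree_fin_two (K := K) (m + n + D)
  have d₂ := two_mul_finrank_restrictTotalDegree_fin_two (K := K) (n + D)
  have d₃ := two_mul_finrank_restrictTotalDegree_fin_two (K := K) (m + D)
  have d₄ := two_mul_finrank_restrictTotalDegree_fin_two (K := K) D
  rw [← hV] at d₁ d₂ d₃ d₄
  have : 2 * s.card + (n + D + 1) * (n + D + 2) + (m + D + 1) * (m + D + 2) ≤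
      (m + n + D + 1) * (m + n + D + 2) + (D + 1) * (D + 2) := by
    omega
  nlinarith

end Bezout

section PDeriv

theorem totalDegree_pderiv_lt {σ R : Type*} [CommSemiring R] {i : σ} {f : MvPolynomial σ R}
    (h : pderiv i f ≠ 0) : (pderiv i f).totalDegree < f.totalDegree := by
  obtain ⟨m, hm, hdeg⟩ := Finset.exists_mem_eq_sup _ (support_nonempty.2 h)
    (fun m => m.sum fun _ e => e)
  have hm' : m + Finsupp.single i 1 ∈ f.support := by
    rw [mem_support_iff, coeff_pderiv] at hm
    exact mem_support_iff.2 (left_ne_zero_of_mul hm)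
  have := le_totalDegree hm'
  rw [Finsupp.sum_add_index' (by simp) (by simp), Finsupp.sum_single_index rfl] at this
  rw [totalDegree, hdeg]
  omega

theorem exists_pderiv_ne_zero {σ R : Type*} [CommSemiring R] [NoZeroDivisors R] [CharZero R]
    {f : MvPolynomial σ R} (h : f.totalDegree ≠ 0) : ∃ i, pderiv i f ≠ 0 := by
  rw [Ne, totalDegree_eq_zero_iff] at h
  push Not at h
  obtain ⟨m, hm, i, hi⟩ := h
  refine ⟨i, fun h0 => ?_⟩
  have := coeff_pderiv (i := i) f (m - Finsupp.single i 1)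
  have hle : Finsupp.single i 1 ≤ m := by
    simpa [Finsupp.single_le_iff] using Nat.one_le_iff_ne_zero.2 hi
  rw [h0, coeff_zero, tsub_add_cancel_of_le hle] at this
  exact mul_ne_zero (mem_support_iff.1 hm) (Nat.cast_add_one_ne_zero _) this.symm

theorem hasDerivAt_eval_update {σ : Type*} [DecidableEq σ] (f : MvPolynomial σ ℝ) (p : σ → ℝ)
    (i : σ) (t : ℝ) :
    HasDerivAt (fun u => eval (Function.update p i u) f)
      (eval (Function.update p i t) (pderiv i f)) t := by
  induction f using MvPolynomial.induction_on with
  | C a => simpa using hasDerivAt_const t a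
  | add f g hf hg => simpa only [map_add] using hf.fun_add hg
  | mul_X f j hf =>
    have hX : HasDerivAt (fun u => Function.update p i u j)
        (eval (Function.update p i t) (pderiv i (X j))) t := by
      rcases eq_or_ne j i with rfl | hj
      · simpa using hasDerivAt_id' t
      · simpa [hj, pderiv_X_of_ne hj] using hasDerivAt_const t (p j)
    convert! hf.fun_mul hX using 1
    · simp
    · simp only [pderiv_mul, map_add, map_mul, eval_X]

end PDeriv

theorem eval_pderiv_eq_zero_of_finite_zeros {f : MvPolynomial (Fin 2) ℝ}
    (hfin : {p : Fin 2 → ℝ | eval p f = 0}.Finite) {p : Fin 2 → ℝ} (hp : eval p f = 0)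
    (i : Fin 2) : eval p (pderiv i f) = 0 := by
  have hconn : IsPreconnected {p : Fin 2 → ℝ | eval p f = 0}ᶜ :=
    (hfin.countable.isConnected_compl_of_one_lt_rank (by simp)).isPreconnected
  have himg := (hconn.image (fun q => eval q f) f.continuous_eval.continuousOn).ordConnected
  have hsign : (∀ q, 0 ≤ eval q f) ∨ ∀ q, eval q f ≤ 0 := by
    by_contra! h
    obtain ⟨⟨a, ha⟩, b, hb⟩ := h
    obtain ⟨q, hq, hq0⟩ := himg.out ⟨a, ha.ne, rfl⟩ ⟨b, hb.ne', rfl⟩ ⟨ha.le, hb.le⟩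
    exact hq hq0
  have hd := hasDerivAt_eval_update f p i (p i)
  rw [Function.update_eq_self] at hd
  refine IsLocalExtr.hasDerivAt_eq_zero (hsign.imp (fun h => ?_) (fun h => ?_)) hd <;>
    exact Filter.Eventually.of_forall fun u => by simpa [hp] using h _

theorem ncard_zeros_le_of_finite {f : MvPolynomial (Fin 2) ℝ} (hf : f ≠ 0)
    (hfin : {p : Fin 2 → ℝ | eval p f = 0}.Finite) :
    {p : Fin 2 → ℝ | eval p f = 0}.ncard ≤ f.totalDegree * (f.totalDegree - 1) := by
  induction f using WfDvdMonoid.induction_on_irreducible with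
  | zero => exact absurd rfl hf
  | unit u hu =>
    have : {p : Fin 2 → ℝ | eval p u = 0} = ∅ :=
      Set.eq_empty_of_forall_notMem fun p hp => (hu.map (eval p)).ne_zero hp
    simp [this]
  | mul a f ha hirr ih =>
    have hunion : {p : Fin 2 → ℝ | eval p (f * a) = 0} =
        {p | eval p f = 0} ∪ {p | eval p a = 0} := by
      ext p; simp
    rw [hunion] at hfin ⊢
    rw [Set.finite_union] at hfin
    have ha' := ih ha hfin.2
    have hf' : {p : Fin 2 → ℝ | eval p f = 0}.ncard ≤ f.totalDegree * (f.totalDegree - 1) := by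
      have hdeg : f.totalDegree ≠ 0 := fun h => by
        have hC := totalDegree_eq_zero_iff_eq_C.1 h
        refine hirr.not_isUnit (hC ▸ (isUnit_iff_ne_zero.2 fun h0 => hirr.ne_zero ?_).map C)
        rw [hC, h0, C_0]
      obtain ⟨i, hi⟩ := exists_pderiv_ne_zero hdeg
      have hlt := totalDegree_pderiv_lt hi
      have hrel : IsRelPrime f (pderiv i f) :=
        hirr.isRelPrime_iff_not_dvd.2 fun h =>
          (totalDegree_le_of_dvd_of_isDomain h hi).not_gt hlt
      rw [Set.ncard_eq_toFinset_card _ hfin.1]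
      refine (card_le_totalDegree_mul_totalDegree hirr.ne_zero hi hrel _ fun p hp => ?_).trans
        (Nat.mul_le_mul_left _ (Nat.le_sub_one_of_lt hlt))
      have hp : eval p f = 0 := by simpa using hp
      exact ⟨hp, eval_pderiv_eq_zero_of_finite_zeros hfin.1 hp i⟩
    refine (Set.ncard_union_le _ _).trans ((add_le_add hf' ha').trans ?_)
    rw [totalDegree_mul_of_isDomain hirr.ne_zero ha, add_mul]
    gcongr <;> omega

end MvPolynomial

theorem stmt_5 (f : MvPolynomial (Fin 2) ℝ) (d : ℕ) (hd : d = f.totalDegree)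
    (hd1 : 1 ≤ d)
    (hfin : Set.Finite {p : ℝ × ℝ | MvPolynomial.eval ![p.1, p.2] f = 0}) :
    Set.ncard {p : ℝ × ℝ | MvPolynomial.eval ![p.1, p.2] f = 0} ≤ d * (d - 1) := by
  subst hd
  have hf : f ≠ 0 := by
    rintro rfl
    simp at hd1
  have himage : (finTwoArrowEquiv ℝ).symm '' {p : ℝ × ℝ | MvPolynomial.eval ![p.1, p.2] f = 0} =
      {p : Fin 2 → ℝ | MvPolynomial.eval p f = 0} := by
    rw [Equiv.image_eq_preimage_symm]
    ext p
    have : ![p 0, p 1] = p := by ext i; fin_cases i <;> rfl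
    simp [this]
  rw [← Set.ncard_image_of_injective _ (finTwoArrowEquiv ℝ).symm.injective, himage]
  exact MvPolynomial.ncard_zeros_le_of_finite hf (himage ▸ hfin.image _)
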